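/- Let α, β ∈ (0,1) and μ be real numbers. Then the function H_μ is differentiable on (2, ∞) and for every real λ > 2 one has H_μ′(λ) = (μ−1)·H_{μ−1}(λ). -/

import Mathlib

open Set

/-- Pochhammer symbol `(a)_n` for real `a`. -/
noncomputable def poch (a : ℝ) (n : ℕ) : ℝ := (ascPochhammer ℝ n).eval a

/-- Generalized hypergeometric function `₃F₂(a₁,a₂,a₃;b₁,b₂;x)` (real version). -/
noncomputable def hyp3F2 (a₁ a₂ a₃ b₁ b₂ x : ℝ) : ℝ :=
  ∑' n : ℕ, poch a₁ n * poch a₂ n * poch a₃ n /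
    (poch b₁ n * poch b₂ n * (n.factorial : ℝ)) * x ^ n

/-- `H_μ(λ) = (1/((1−α)(1−β)))·(λ−1)^{μ−1}·₃F₂(1,1,1−μ;2−α,2−β;1/(1−λ))`. -/
noncomputable def Hfun (α β μ : ℝ) : ℝ → ℝ :=
  fun x => (1 / ((1 - α) * (1 - β))) * (x - 1) ^ (μ - 1) *
    hyp3F2 1 1 (1 - μ) (2 - α) (2 - β) (1 / (1 - x))

lemma poch_succ (a : ℝ) (n : ℕ) : poch a (n + 1) = poch a n * (a + n) :=
  ascPochhammer_succ_eval n a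

lemma poch_mul_add (a : ℝ) (n : ℕ) : poch a n * (a + n) = a * poch (a + 1) n := by
  rw [← poch_succ]
  simp [poch, ascPochhammer_succ_left, Polynomial.eval_comp]

lemma poch_pos {a : ℝ} (ha : 0 < a) (n : ℕ) : 0 < poch a n :=
  ascPochhammer_pos n a ha

/-- The coefficients of the series `hyp3F2`. -/
noncomputable def hyp3F2Coeff (a₁ a₂ a₃ b₁ b₂ : ℝ) (n : ℕ) : ℝ :=
  poch a₁ n * poch a₂ n * poch a₃ n / (poch b₁ n * poch b₂ n * (n.factorial : ℝ))

lemma hyp3F2_eq_tsum (a₁ a₂ a₃ b₁ b₂ x : ℝ) :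
    hyp3F2 a₁ a₂ a₃ b₁ b₂ x = ∑' n : ℕ, hyp3F2Coeff a₁ a₂ a₃ b₁ b₂ n * x ^ n :=
  rfl

lemma hyp3F2Coeff_succ (a₁ a₂ a₃ : ℝ) {b₁ b₂ : ℝ} (hb₁ : 0 < b₁) (hb₂ : 0 < b₂) (n : ℕ) :
    hyp3F2Coeff a₁ a₂ a₃ b₁ b₂ (n + 1) =
      hyp3F2Coeff a₁ a₂ a₃ b₁ b₂ n *
        ((a₁ + n) / (b₁ + n) * ((a₂ + n) / (b₂ + n)) * ((a₃ + n) / (1 + n))) := by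
  have h₁ := poch_pos hb₁ n
  have h₂ := poch_pos hb₂ n
  have h₃ : (0 : ℝ) < n.factorial := by positivity
  simp only [hyp3F2Coeff, poch_succ, Nat.factorial_succ]
  push_cast
  field_simp
  ring

lemma natCast_mul_hyp3F2Coeff (a₁ a₂ a₃ b₁ b₂ : ℝ) (n : ℕ) :
    n * hyp3F2Coeff a₁ a₂ a₃ b₁ b₂ n =
      a₃ * (hyp3F2Coeff a₁ a₂ (a₃ + 1) b₁ b₂ n - hyp3F2Coeff a₁ a₂ a₃ b₁ b₂ n) := by
  have h := poch_mul_add a₃ n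
  simp only [hyp3F2Coeff]
  linear_combination (poch a₁ n * poch a₂ n / (poch b₁ n * poch b₂ n * n.factorial)) * h

lemma tendsto_add_natCast_div_add_natCast (a b : ℝ) :
    Filter.Tendsto (fun n : ℕ => (a + n) / (b + n)) Filter.atTop (nhds 1) := by
  simpa using tendsto_add_mul_div_add_mul_atTop_nhds a b (1 : ℝ) one_ne_zero

lemma summable_hyp3F2 (a₁ a₂ a₃ : ℝ) {b₁ b₂ x : ℝ} (hb₁ : 0 < b₁) (hb₂ : 0 < b₂)
    (hx : |x| < 1) : Summable fun n : ℕ => hyp3F2Coeff a₁ a₂ a₃ b₁ b₂ n * x ^ n := by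
  obtain ⟨r, hxr, hr⟩ := exists_between hx
  have hlim : Filter.Tendsto (fun n : ℕ =>
      |(a₁ + n) / (b₁ + n) * ((a₂ + n) / (b₂ + n)) * ((a₃ + n) / (1 + n)) * x|)
      Filter.atTop (nhds |x|) := by
    simpa using ((((tendsto_add_natCast_div_add_natCast a₁ b₁).mul
      (tendsto_add_natCast_div_add_natCast a₂ b₂)).mul
      (tendsto_add_natCast_div_add_natCast a₃ 1)).mul_const x).abs
  refine summable_of_ratio_norm_eventually_le hr ?_
  filter_upwards [hlim.eventually_le_const hxr] with n hn
  calc ‖hyp3F2Coeff a₁ a₂ a₃ b₁ b₂ (n + 1) * x ^ (n + 1)‖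
      = |(a₁ + n) / (b₁ + n) * ((a₂ + n) / (b₂ + n)) * ((a₃ + n) / (1 + n)) * x| *
          ‖hyp3F2Coeff a₁ a₂ a₃ b₁ b₂ n * x ^ n‖ := by
        rw [hyp3F2Coeff_succ _ _ _ hb₁ hb₂, ← Real.norm_eq_abs, ← norm_mul]
        ring_nf
    _ ≤ r * ‖hyp3F2Coeff a₁ a₂ a₃ b₁ b₂ n * x ^ n‖ := by gcongr

/-- The operator `x d/dx` expressed through the contiguous function `a₃ ↦ a₃ + 1`. -/
lemma hasDerivAt_hyp3F2 (a₁ a₂ a₃ : ℝ) {b₁ b₂ x : ℝ} (hb₁ : 0 < b₁) (hb₂ : 0 < b₂)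
    (hx : |x| < 1) (hx0 : x ≠ 0) :
    HasDerivAt (hyp3F2 a₁ a₂ a₃ b₁ b₂)
      (a₃ * (hyp3F2 a₁ a₂ (a₃ + 1) b₁ b₂ x - hyp3F2 a₁ a₂ a₃ b₁ b₂ x) / x) x := by
  have hpow (n : ℕ) {y : ℝ} (hy : y ≠ 0) : (n : ℝ) * y ^ (n - 1) = n * y ^ n / y := by
    cases n with
    | zero => simp
    | succ m => rw [pow_succ, Nat.add_sub_cancel]; field_simp
  have hterm {y : ℝ} (hy : y ≠ 0) (n : ℕ) :
      hyp3F2Coeff a₁ a₂ a₃ b₁ b₂ n * (n * y ^ (n - 1)) =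
        a₃ * (hyp3F2Coeff a₁ a₂ (a₃ + 1) b₁ b₂ n * y ^ n -
          hyp3F2Coeff a₁ a₂ a₃ b₁ b₂ n * y ^ n) / y := by
    rw [hpow n hy]
    linear_combination (y ^ n / y) * natCast_mul_hyp3F2Coeff a₁ a₂ a₃ b₁ b₂ n
  have hsum {y : ℝ} (hy : |y| < 1) (hy0 : y ≠ 0) : HasSum
      (fun n : ℕ => hyp3F2Coeff a₁ a₂ a₃ b₁ b₂ n * (n * y ^ (n - 1)))
      (a₃ * (hyp3F2 a₁ a₂ (a₃ + 1) b₁ b₂ y - hyp3F2 a₁ a₂ a₃ b₁ b₂ y) / y) := by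
    simp_rw [hterm hy0]
    exact (((summable_hyp3F2 a₁ a₂ (a₃ + 1) hb₁ hb₂ hy).hasSum.sub
      (summable_hyp3F2 a₁ a₂ a₃ hb₁ hb₂ hy).hasSum).mul_left a₃).div_const y
  obtain ⟨r, hxr, hr⟩ := exists_between hx
  have hr0 : 0 < r := (abs_nonneg x).trans_lt hxr
  have hxball : x ∈ Metric.ball (0 : ℝ) r := by simpa using hxr
  rw [← (hsum hx hx0).tsum_eq, funext (hyp3F2_eq_tsum a₁ a₂ a₃ b₁ b₂)]
  refine hasDerivAt_tsum_of_isPreconnected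
    (hsum (by rwa [abs_of_pos hr0]) hr0.ne').summable.norm Metric.isOpen_ball
    (convex_ball (0 : ℝ) r).isPreconnected
    (fun n y _ => (hasDerivAt_pow n y).const_mul _) (fun n y hy => ?_) hxball
    (summable_hyp3F2 a₁ a₂ a₃ hb₁ hb₂ hx) hxball
  have hy' : ‖y‖ ≤ ‖r‖ := by
    rw [Real.norm_of_nonneg hr0.le]
    exact (mem_ball_zero_iff.1 hy).le
  simp only [norm_mul, norm_pow]
  gcongr

/-- for `α, β ∈ (0,1)` and `μ ∈ ℝ`, `H_μ` is differentiable on `(2,∞)` with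
`H_μ′(λ) = (μ−1)·H_{μ−1}(λ)`. -/
theorem stmt9 (α β μ : ℝ) (hα : α ∈ Ioo (0 : ℝ) 1) (hβ : β ∈ Ioo (0 : ℝ) 1) :
    ∀ x : ℝ, 2 < x →
      HasDerivAt (Hfun α β μ) ((μ - 1) * Hfun α β (μ - 1) x) x := by
  intro x hx
  have hx1 : 0 < x - 1 := by linarith
  have hx1' : 1 - x ≠ 0 := by linarith
  have hz : |1 / (1 - x)| < 1 := by
    rw [abs_div, abs_one, abs_sub_comm, abs_of_pos hx1, div_lt_one hx1]
    linarith
  have hF := hasDerivAt_hyp3F2 1 1 (1 - μ) (b₁ := 2 - α) (b₂ := 2 - β)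
    (by linarith [hα.2]) (by linarith [hβ.2]) hz (one_div_ne_zero hx1')
  have hinv : HasDerivAt (fun y : ℝ => 1 / (1 - y)) (1 / (1 - x) ^ 2) x := by
    simpa using ((hasDerivAt_id x).const_sub 1).fun_inv hx1'
  have hpow : HasDerivAt (fun y : ℝ => (y - 1) ^ (μ - 1))
      ((μ - 1) * (x - 1) ^ (μ - 1 - 1)) x := by
    simpa using ((hasDerivAt_id x).sub_const 1).rpow_const (p := μ - 1) (Or.inl hx1.ne')
  refine ((hpow.const_mul (1 / ((1 - α) * (1 - β)))).mul (hF.comp x hinv)).congr_deriv ?_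
  have hshift : (x - 1) ^ (μ - 1) = (x - 1) ^ (μ - 1 - 1) * (x - 1) := by
    rw [Real.rpow_sub_one hx1.ne' (μ - 1), div_mul_cancel₀ _ hx1.ne']
  have hcancel : (x - 1) * (1 / (1 / (1 - x)) * (1 / (1 - x) ^ 2)) = -1 := by
    field_simp
    ring
  simp only [Hfun, Function.comp_apply, hshift, show 1 - (μ - 1) = 1 - μ + 1 by ring]
  linear_combination (1 / ((1 - α) * (1 - β))) * (x - 1) ^ (μ - 1 - 1) * (1 - μ) *
    (hyp3F2 1 1 (1 - μ + 1) (2 - α) (2 - β) (1 / (1 - x)) -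
      hyp3F2 1 1 (1 - μ) (2 - α) (2 - β) (1 / (1 - x))) * hcancel
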